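/- Let p ≥ (n+2)/(n−2). Assume ψ satisfies (H1)–(H2), lim_{r→∞} ψ'(r)/ψ(r) = l ∈ (0, +∞], the function A(r) = (∫₀^r ψ(s)^{n−1} ds)^{(p−1)/(2(p+1))} is convex on [0, ∞), and, in case l = +∞, that [log(ψ'(r)/ψ(r))]' is bounded as r → ∞. Let u be a radial solution with u(r) > 0 for all r ≥ 0. Then: (i) if ∫₀^∞ ψ(s)/ψ'(s) ds < ∞, then lim_{r→∞} u(r) exists and is a strictly positive real number; (ii) if ∫₀^∞ ψ(s)/ψ'(s) ds = ∞, then lim_{r→∞} (∫₀^r ψ(s)/ψ'(s) ds)^{1/(p−1)} u(r) = ((n−1)/(p−1))^{1/(p−1)}, and in particular if l < +∞ then lim_{r→∞} r^{1/(p−1)} u(r) = (l(n−1)/(p−1))^{1/(p−1)}. -/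

import Mathlib

open Real MeasureTheory Filter Set Asymptotics

noncomputable section

/-- (H1): ψ is C² on [0,∞), ψ(0) = ψ''(0) = 0, ψ'(0) = 1, ψ > 0 on (0,∞). -/
def H1 (ψ : ℝ → ℝ) : Prop :=
  ContDiffOn ℝ 2 ψ (Ici 0) ∧ ψ 0 = 0 ∧ deriv ψ 0 = 1 ∧
    deriv (deriv ψ) 0 = 0 ∧ ∀ r > (0 : ℝ), 0 < ψ r

/-- (H2): ψ' ≥ 0 on (0,∞). -/
def H2 (ψ : ℝ → ℝ) : Prop := ∀ r > (0 : ℝ), 0 ≤ deriv ψ r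

/-- (H3): liminf_{r→∞} ψ'(r)/ψ(r) > 0, i.e. ψ'/ψ is eventually bounded below
by a positive constant. -/
def H3 (ψ : ℝ → ℝ) : Prop := ∃ c > (0 : ℝ), ∀ᶠ r in atTop, c ≤ deriv ψ r / ψ r

/-- A radial solution of the Lane–Emden–Fowler equation with initial value α. -/
def IsRadialSolution (n : ℕ) (p : ℝ) (ψ u : ℝ → ℝ) (α : ℝ) : Prop :=
  ContDiffOn ℝ 2 u (Ici 0) ∧ u 0 = α ∧ deriv u 0 = 0 ∧
    ∀ r > (0 : ℝ), deriv (deriv u) r + ((n : ℝ) - 1) * (deriv ψ r / ψ r) * deriv u r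
      + |u r| ^ (p - 1) * u r = 0

/-- A(r) = (∫₀^r ψ(s)^{n-1} ds)^{(p-1)/(2(p+1))}. -/
def Afun (n : ℕ) (p : ℝ) (ψ : ℝ → ℝ) : ℝ → ℝ := fun r =>
  (∫ s in Ioc (0:ℝ) r, ψ s ^ (n - 1)) ^ ((p - 1) / (2 * (p + 1)))

/-- [log(ψ'/ψ)]' is bounded as r → ∞. -/
def LogDerivBounded (ψ : ℝ → ℝ) : Prop :=
  ∃ C : ℝ, ∀ᶠ r in atTop, |deriv (fun s => Real.log (deriv ψ s / ψ s)) r| ≤ C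

lemma antitoneOn_of_hasDerivAt_nonpos {s : Set ℝ} (hs : Convex ℝ s) {f f' : ℝ → ℝ}
    (hf : ∀ r ∈ s, HasDerivAt f (f' r) r) (hf' : ∀ r ∈ s, f' r ≤ 0) : AntitoneOn f s := by
  refine antitoneOn_of_deriv_nonpos hs (fun r hr => (hf r hr).continuousAt.continuousWithinAt)
    (fun r hr => (hf r (interior_subset hr)).differentiableAt.differentiableWithinAt) ?_
  intro r hr
  rw [(hf r (interior_subset hr)).deriv]
  exact hf' r (interior_subset hr)

/-- A function that decreases at a definite rate whenever it is at least `c` is eventually at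
most `c`. -/
lemma eventually_le_of_deriv_le {f f' : ℝ → ℝ} {c δ : ℝ} (hδ : 0 < δ)
    (h : ∀ᶠ r in atTop, HasDerivAt f (f' r) r ∧ (c ≤ f r → f' r ≤ -δ)) :
    ∀ᶠ r in atTop, f r ≤ c := by
  obtain ⟨R, hR⟩ := eventually_atTop.1 h
  have hex : ∃ r₁ ≥ R, f r₁ ≤ c := by
    by_contra! hcon
    have hanti : AntitoneOn (fun r => f r + δ * r) (Ici R) := by
      refine antitoneOn_of_hasDerivAt_nonpos (f' := fun r => f' r + δ * 1) (convex_Ici R)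
        (fun r hr => (hR r hr).1.add ((hasDerivAt_id r).const_mul δ)) (fun r hr => ?_)
      have := (hR r hr).2 (hcon r hr).le
      linarith
    have hRc := hcon R le_rfl
    have hle : R ≤ R + (f R - c) / δ := by
      have : 0 ≤ (f R - c) / δ := div_nonneg (by linarith) hδ.le
      linarith
    have h1 := hanti (mem_Ici.2 le_rfl) (mem_Ici.2 hle) hle
    have h2 := hcon _ hle
    have h3 : δ * (R + (f R - c) / δ) = δ * R + (f R - c) := by field_simp
    simp only [h3] at h1
    linarith
  obtain ⟨r₁, hr₁, hfr₁⟩ := hex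
  filter_upwards [eventually_ge_atTop r₁] with r hr
  refine image_le_of_deriv_right_lt_deriv_boundary (f' := f') (a := r₁) (b := r)
    (B := fun _ => c) (B' := fun _ => 0)
    (fun x hx => (hR x (hr₁.trans hx.1)).1.continuousAt.continuousWithinAt)
    (fun x hx => (hR x (hr₁.trans hx.1)).1.hasDerivWithinAt) hfr₁
    (fun x => hasDerivAt_const x c) (fun x hx hxc => ?_) ⟨hr, le_rfl⟩
  have := (hR x (hr₁.trans hx.1)).2 hxc.ge
  linarith

/-- One half of L'Hôpital's rule for `F / G` with `G → ∞`. -/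
lemma eventually_le_mul_of_deriv_le {F F' G G' : ℝ → ℝ} {k K : ℝ} (hkK : k < K)
    (hF : ∀ᶠ r in atTop, HasDerivAt F (F' r) r) (hG : ∀ᶠ r in atTop, HasDerivAt G (G' r) r)
    (hle : ∀ᶠ r in atTop, F' r ≤ k * G' r) (hGtop : Tendsto G atTop atTop) :
    ∀ᶠ r in atTop, F r ≤ K * G r := by
  obtain ⟨R, hR⟩ := eventually_atTop.1 (hF.and (hG.and hle))
  have hanti : AntitoneOn (fun r => F r - k * G r) (Ici R) :=
    antitoneOn_of_hasDerivAt_nonpos (f' := fun r => F' r - k * G' r) (convex_Ici R)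
      (fun r hr => (hR r hr).1.sub ((hR r hr).2.1.const_mul k))
      (fun r hr => by have := (hR r hr).2.2; linarith)
  filter_upwards [eventually_ge_atTop R,
    hGtop.eventually_ge_atTop ((F R - k * G R) / (K - k))] with r hr hGr
  have h1 := hanti (mem_Ici.2 le_rfl) (mem_Ici.2 hr) hr
  simp only at h1
  rw [div_le_iff₀ (by linarith)] at hGr
  linarith

/-- L'Hôpital's rule at infinity for `F / G` with `G → ∞`. -/
lemma tendsto_div_of_deriv_div {F F' G G' : ℝ → ℝ} {k : ℝ}
    (hF : ∀ᶠ r in atTop, HasDerivAt F (F' r) r) (hG : ∀ᶠ r in atTop, HasDerivAt G (G' r) r)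
    (hG' : ∀ᶠ r in atTop, 0 < G' r) (hlim : Tendsto (fun r => F' r / G' r) atTop (nhds k))
    (hGtop : Tendsto G atTop atTop) : Tendsto (fun r => F r / G r) atTop (nhds k) := by
  have hpos := hGtop.eventually_gt_atTop 0
  refine tendsto_order.2 ⟨fun a ha => ?_, fun a ha => ?_⟩
  · obtain ⟨b, hab, hbk⟩ := exists_between ha
    obtain ⟨b', hbb', hbk'⟩ := exists_between hbk
    have := eventually_le_mul_of_deriv_le (F := fun r => -F r) (F' := fun r => -F' r)
      (G := G) (G' := G') (k := -b') (K := -b) (by linarith)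
      (hF.mono fun r h => h.neg) hG ?_ hGtop
    · filter_upwards [this, hpos] with r hr hGr
      rw [lt_div_iff₀ hGr]
      nlinarith
    · filter_upwards [hlim.eventually_const_lt hbk', hG'] with r hr hGr
      rw [lt_div_iff₀ hGr] at hr
      linarith
  · obtain ⟨b, hkb, hba⟩ := exists_between ha
    obtain ⟨b', hkb', hbb'⟩ := exists_between hkb
    have := eventually_le_mul_of_deriv_le (F := F) (F' := F')
      (G := G) (G' := G') (k := b') (K := b) hbb' hF hG ?_ hGtop
    · filter_upwards [this, hpos] with r hr hGr
      rw [div_lt_iff₀ hGr]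
      nlinarith
    · filter_upwards [hlim.eventually_lt_const hkb', hG'] with r hr hGr
      rw [div_lt_iff₀ hGr] at hr
      linarith

/-- Solutions of `y' = b (1 - y e)` with `e → 1` and `b` bounded below tend to `1`. -/
lemma tendsto_one_of_deriv_eq {y b e : ℝ → ℝ} {c : ℝ} (hc : 0 < c)
    (hb : ∀ᶠ r in atTop, c ≤ b r)
    (hy : ∀ᶠ r in atTop, HasDerivAt y (b r * (1 - y r * e r)) r)
    (he : Tendsto e atTop (nhds 1)) : Tendsto y atTop (nhds 1) := by
  have key : ∀ ε > 0, (∀ᶠ r in atTop, y r ≤ 1 + ε) ∧ ∀ᶠ r in atTop, -y r ≤ -(1 - ε) := by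
    intro ε hε
    have hup : Tendsto (fun r => 1 - (1 + ε) * e r) atTop (nhds (-ε)) := by
      have := (he.const_mul (1 + ε)).const_sub 1
      convert this using 2; ring
    have hdn : Tendsto (fun r => 1 - (1 - ε) * e r) atTop (nhds ε) := by
      have := (he.const_mul (1 - ε)).const_sub 1
      convert this using 2; ring
    constructor
    · refine eventually_le_of_deriv_le (δ := c * (ε / 2)) (by positivity)
        (f' := fun r => b r * (1 - y r * e r)) ?_
      filter_upwards [hb, hy, he.eventually_const_lt (zero_lt_one),
        hup.eventually_lt_const (show -ε < -(ε / 2) by linarith)] with r h1 h2 h3 h4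
      refine ⟨h2, fun h5 => ?_⟩
      have h6 : 1 - y r * e r ≤ -(ε / 2) := by nlinarith
      nlinarith
    · refine eventually_le_of_deriv_le (δ := c * (ε / 2)) (by positivity)
        (f' := fun r => -(b r * (1 - y r * e r))) ?_
      filter_upwards [hb, hy, he.eventually_const_lt (zero_lt_one),
        hdn.eventually_const_lt (show ε / 2 < ε by linarith)] with r h1 h2 h3 h4
      refine ⟨h2.neg, fun h5 => ?_⟩
      have h6 : ε / 2 ≤ 1 - y r * e r := by nlinarith
      nlinarith
  refine tendsto_order.2 ⟨fun a ha => ?_, fun a ha => ?_⟩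
  · filter_upwards [(key ((1 - a) / 2) (by linarith)).2] with r hr
    linarith
  · filter_upwards [(key ((a - 1) / 2) (by linarith)).1] with r hr
    linarith

/-- Asymptotics of the slow branch of the Riccati system
`v' = v² - a v + x`, `x' = -(p - 1) v x`. -/
lemma riccati_slow_branch {p θ c : ℝ} (hθ : θ < 1) (hc : 0 < c) {a b b' v x : ℝ → ℝ}
    (hv : ∀ᶠ r in atTop, HasDerivAt v (v r ^ 2 - a r * v r + x r) r)
    (hx : ∀ᶠ r in atTop, HasDerivAt x (-((p - 1) * v r * x r)) r)
    (hb : ∀ᶠ r in atTop, HasDerivAt b (b' r) r)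
    (hvpos : ∀ᶠ r in atTop, 0 < v r) (hxpos : ∀ᶠ r in atTop, 0 < x r)
    (hbc : ∀ᶠ r in atTop, c ≤ b r) (hva : ∀ᶠ r in atTop, v r ≤ θ * a r)
    (hb' : Tendsto (fun r => b' r / b r ^ 2) atTop (nhds 0))
    (hab : Tendsto (fun r => a r / b r) atTop (nhds 1))
    (hxb : Tendsto (fun r => x r / b r ^ 2) atTop (nhds 0)) :
    Tendsto (fun r => b r * v r / x r) atTop (nhds 1) := by
  have hz : Tendsto (fun r => v r / b r) atTop (nhds 0) := by
    refine tendsto_order.2 ⟨fun d hd => ?_, fun d hd => ?_⟩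
    · filter_upwards [hvpos, hbc] with r h1 h2
      exact hd.trans (div_pos h1 (hc.trans_le h2))
    · set κ := 1 - θ with hκ
      have hκ0 : 0 < κ := by linarith
      have hcoef : Tendsto (fun r => -κ * (a r / b r) - b' r / b r ^ 2) atTop (nhds (-κ)) := by
        simpa using (hab.const_mul (-κ)).sub hb'
      have : ∀ᶠ r in atTop, v r / b r ≤ d / 2 := by
        refine eventually_le_of_deriv_le (δ := c * (κ / 4 * (d / 2))) (by positivity)
          (f' := fun r => ((v r ^ 2 - a r * v r + x r) * b r - v r * b' r) / b r ^ 2) ?_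
        filter_upwards [hv, hb, hvpos, hbc, hva,
          hcoef.eventually_lt_const (show -κ < -(κ / 2) by linarith),
          hxb.eventually_lt_const (show 0 < κ / 4 * (d / 2) by positivity)] with
          r h1 h2 h3 h4 h5 h6 h7
        have hb0 : 0 < b r := hc.trans_le h4
        refine ⟨h1.div h2 hb0.ne', fun h8 => ?_⟩
        have h9 : ((v r ^ 2 - a r * v r + x r) * b r - v r * b' r) / b r ^ 2
            ≤ b r * (v r / b r * (-κ * (a r / b r) - b' r / b r ^ 2) + x r / b r ^ 2) := by
          have : b r * (v r / b r * (-κ * (a r / b r) - b' r / b r ^ 2) + x r / b r ^ 2)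
              = ((-κ * a r * v r + x r) * b r - v r * b' r) / b r ^ 2 := by
            field_simp
            ring
          rw [this]
          have : v r ^ 2 - a r * v r ≤ -κ * a r * v r := by rw [hκ]; nlinarith
          gcongr
        have h10 : v r / b r * (-κ * (a r / b r) - b' r / b r ^ 2) + x r / b r ^ 2
            ≤ -(κ / 4 * (d / 2)) := by
          have : v r / b r * (-κ * (a r / b r) - b' r / b r ^ 2) ≤ d / 2 * (-(κ / 2)) := by
            nlinarith
          linarith
        have : 0 < κ / 4 * (d / 2) := by positivity
        nlinarith
      filter_upwards [this] with r hr
      linarith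
  refine tendsto_one_of_deriv_eq (e := fun r => a r / b r - b' r / b r ^ 2 - p * (v r / b r))
    hc hbc ?_ (by simpa using (hab.sub hb').sub (hz.const_mul p))
  filter_upwards [hv, hx, hb, hxpos, hbc] with r h1 h2 h3 h4 h5
  have hb0 : b r ≠ 0 := (hc.trans_le h5).ne'
  refine ((h3.mul h1).div h2 h4.ne').congr_deriv ?_
  simp only [Pi.mul_apply]
  field_simp
  ring

lemma setIntegral_Ioc_eq_intervalIntegral_max (f : ℝ → ℝ) {r : ℝ} (hr : 0 ≤ r) :
    ∫ s in Ioc 0 r, f s = ∫ s in (0 : ℝ)..r, f (max 0 s) := by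
  rw [intervalIntegral.integral_of_le hr]
  refine setIntegral_congr_fun measurableSet_Ioc fun s hs => ?_
  simp only [max_eq_right hs.1.le]

lemma continuous_comp_max {f : ℝ → ℝ} (hf : ContinuousOn f (Ici 0)) :
    Continuous fun s => f (max 0 s) :=
  hf.comp_continuous (by fun_prop) fun s => le_max_left 0 s

lemma hasDerivAt_setIntegral_Ioc {f : ℝ → ℝ} (hf : ContinuousOn f (Ici 0)) {r : ℝ}
    (hr : 0 < r) : HasDerivAt (fun r => ∫ s in Ioc 0 r, f s) (f r) r := by
  have h := ((continuous_comp_max hf).integral_hasStrictDerivAt 0 r).hasDerivAt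
  rw [max_eq_right hr.le] at h
  refine h.congr_of_eventuallyEq ?_
  filter_upwards [eventually_gt_nhds hr] with s hs
  exact setIntegral_Ioc_eq_intervalIntegral_max f hs.le

lemma tendsto_setIntegral_Ioc_zero {f : ℝ → ℝ} (hf : ContinuousOn f (Ici 0)) :
    Tendsto (fun r => ∫ s in Ioc 0 r, f s) (nhdsWithin 0 (Ioi 0)) (nhds 0) := by
  have h := ((continuous_comp_max hf).integral_hasStrictDerivAt 0 0).hasDerivAt.continuousAt.tendsto
  rw [intervalIntegral.integral_same] at h
  refine (h.mono_left nhdsWithin_le_nhds).congr' ?_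
  filter_upwards [self_mem_nhdsWithin] with s hs
  exact (setIntegral_Ioc_eq_intervalIntegral_max f (le_of_lt hs)).symm

lemma setIntegral_Ioc_pos {f : ℝ → ℝ} (hf : ContinuousOn f (Ici 0))
    (hpos : ∀ r > 0, 0 < f r) {r : ℝ} (hr : 0 < r) : 0 < ∫ s in Ioc 0 r, f s := by
  rw [setIntegral_Ioc_eq_intervalIntegral_max f hr.le]
  refine intervalIntegral.intervalIntegral_pos_of_pos_on
    ((continuous_comp_max hf).intervalIntegrable _ _) (fun s hs => ?_) hr
  rw [max_eq_right hs.1.le]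
  exact hpos s hs.1

/-- The primitive of a nonnegative function that is not integrable diverges. -/
lemma tendsto_setIntegral_Ioc_atTop {f : ℝ → ℝ} (hf : ContinuousOn f (Ici 0))
    (hnn : ∀ r > 0, 0 ≤ f r) (hint : ¬ IntegrableOn f (Ioi 0)) :
    Tendsto (fun r => ∫ s in Ioc 0 r, f s) atTop atTop := by
  have hloc : ∀ r, IntegrableOn f (Ioc 0 r) := fun r =>
    ((hf.mono Icc_subset_Ici_self).integrableOn_Icc (b := r)).mono_set Ioc_subset_Icc_self
  have hmono : Monotone (fun r => ∫ s in Ioc 0 r, f s) := by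
    intro r s hrs
    refine setIntegral_mono_set (hloc s) ?_ (Ioc_subset_Ioc_right hrs).eventuallyLE
    filter_upwards [ae_restrict_mem measurableSet_Ioc] with t ht
    exact hnn t ht.1
  refine tendsto_atTop_atTop_of_monotone hmono fun B => ?_
  by_contra! hB
  refine hint (integrableOn_Ioi_of_intervalIntegral_norm_bounded B 0 hloc tendsto_id ?_)
  filter_upwards [eventually_ge_atTop 0] with r hr
  rw [intervalIntegral.integral_of_le hr]
  refine le_trans (le_of_eq ?_) (hB r).le
  refine setIntegral_congr_fun measurableSet_Ioc fun s hs => ?_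
  exact Real.norm_of_nonneg (hnn s hs.1)

lemma setIntegral_Ioc_le_Ioi {f : ℝ → ℝ} (hnn : ∀ r > 0, 0 ≤ f r)
    (hint : IntegrableOn f (Ioi 0)) (r : ℝ) :
    ∫ s in Ioc 0 r, f s ≤ ∫ s in Ioi 0, f s := by
  refine setIntegral_mono_set hint ?_ Ioc_subset_Ioi_self.eventuallyLE
  filter_upwards [ae_restrict_mem measurableSet_Ioi] with t ht
  exact hnn t ht

lemma ContDiffOn.hasDerivAt_of_pos {f : ℝ → ℝ} (hf : ContDiffOn ℝ 2 f (Ici 0)) {r : ℝ}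
    (hr : 0 < r) : HasDerivAt f (deriv f r) r ∧ HasDerivAt (deriv f) (deriv (deriv f) r) r := by
  have hat : ContDiffAt ℝ 2 f r := hf.contDiffAt (Ici_mem_nhds hr)
  refine ⟨(hat.differentiableAt (by norm_num)).hasDerivAt, ?_⟩
  have : ContDiffOn ℝ 1 (deriv f) (Ioi 0) :=
    ((contDiffOn_succ_iff_deriv_of_isOpen (n := 1) isOpen_Ioi).1
      (by simpa [one_add_one_eq_two] using hf.mono Ioi_subset_Ici_self)).2.2
  exact ((this.contDiffAt (Ioi_mem_nhds hr)).differentiableAt (by norm_num)).hasDerivAt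

lemma ContDiffOn.continuousOn_derivWithin_Ici {f : ℝ → ℝ} (hf : ContDiffOn ℝ 2 f (Ici 0)) :
    ContinuousOn (derivWithin f (Ici 0)) (Ici 0) :=
  hf.continuousOn_derivWithin (uniqueDiffOn_Ici 0) (by norm_num)

lemma derivWithin_Ici_of_pos (f : ℝ → ℝ) {r : ℝ} (hr : 0 < r) :
    derivWithin f (Ici 0) r = deriv f r :=
  derivWithin_of_mem_nhds (Ici_mem_nhds hr)

lemma nonpos_of_tendsto_zero_of_hasDerivAt_nonpos {f f' : ℝ → ℝ}
    (hf : ∀ r > 0, HasDerivAt f (f' r) r) (hf' : ∀ r > 0, f' r ≤ 0)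
    (h0 : Tendsto f (nhdsWithin 0 (Ioi 0)) (nhds 0)) {r : ℝ} (hr : 0 < r) : f r ≤ 0 := by
  have hanti := antitoneOn_of_hasDerivAt_nonpos (convex_Ioi 0) hf hf'
  refine ge_of_tendsto h0 ?_
  filter_upwards [Ioo_mem_nhdsGT hr] with s hs
  exact hanti hs.1 hr hs.2.le

lemma neg_of_tendsto_zero_of_hasDerivAt_neg {f f' : ℝ → ℝ}
    (hf : ∀ r > 0, HasDerivAt f (f' r) r) (hf' : ∀ r > 0, f' r < 0)
    (h0 : Tendsto f (nhdsWithin 0 (Ioi 0)) (nhds 0)) {r : ℝ} (hr : 0 < r) : f r < 0 := by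
  have hle : ∀ s > 0, f s ≤ 0 := fun s hs =>
    nonpos_of_tendsto_zero_of_hasDerivAt_nonpos hf (fun r hr => (hf' r hr).le) h0 hs
  refine lt_of_le_of_ne (hle r hr) fun h => (hf' r hr).ne ?_
  have hmax : IsLocalMax f r := by
    filter_upwards [eventually_gt_nhds hr] with s hs
    rw [h]
    exact hle s hs
  exact hmax.hasDerivAt_eq_zero (hf r hr)

/-- Convexity of a power `V ^ q` of a function with `V' = w`, `w' = a w`. -/
lemma mul_le_mul_of_convexOn_rpow {V w a : ℝ → ℝ} {q : ℝ} (hq : 0 < q)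
    (hV : ∀ r > 0, HasDerivAt V (w r) r) (hw : ∀ r > 0, HasDerivAt w (a r * w r) r)
    (hVpos : ∀ r > 0, 0 < V r) (hwpos : ∀ r > 0, 0 < w r)
    (hconv : ConvexOn ℝ (Ici 0) fun r => V r ^ q) {r : ℝ} (hr : 0 < r) :
    (1 - q) * w r ≤ a r * V r := by
  have hd : ∀ s > 0, HasDerivAt (fun r => V r ^ q) (w s * q * V s ^ (q - 1)) s := fun s hs =>
    (hV s hs).rpow_const (Or.inl (hVpos s hs).ne')
  have hmono : MonotoneOn (fun s => w s * q * V s ^ (q - 1)) (Ioi 0) := by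
    have h := (hconv.subset Ioi_subset_Ici_self (convex_Ioi 0)).monotoneOn_deriv
      (fun s hs => (hd s hs).differentiableAt)
    refine h.congr fun s hs => (hd s hs).deriv
  have hd2 : HasDerivAt (fun s => w s * q * V s ^ (q - 1))
      (a r * w r * q * V r ^ (q - 1) + w r * q * (w r * (q - 1) * V r ^ (q - 1 - 1))) r :=
    ((hw r hr).mul_const q).mul ((hV r hr).rpow_const (Or.inl (hVpos r hr).ne'))
  have hnn : 0 ≤ a r * w r * q * V r ^ (q - 1) + w r * q * (w r * (q - 1) * V r ^ (q - 1 - 1)) := by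
    rw [← hd2.hasDerivWithinAt.derivWithin (isOpen_Ioi.uniqueDiffWithinAt hr)]
    exact hmono.derivWithin_nonneg
  have hsplit : V r ^ (q - 1) = V r * V r ^ (q - 1 - 1) := by
    rw [Real.rpow_sub_one (hVpos r hr).ne' (q - 1)]
    field_simp [(hVpos r hr).ne']
  rw [hsplit] at hnn
  have hfac : 0 < w r * q * V r ^ (q - 1 - 1) :=
    mul_pos (mul_pos (hwpos r hr) hq) (Real.rpow_pos_of_pos (hVpos r hr) _)
  have : 0 ≤ (w r * q * V r ^ (q - 1 - 1)) * (a r * V r - (1 - q) * w r) := by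
    refine hnn.trans (le_of_eq ?_); ring
  linarith [nonneg_of_mul_nonneg_right this hfac]

/-- The Pohozaev identity bounds the logarithmic derivative of a positive solution of
`u'' + a u' + u ^ p = 0` by a fraction of the friction coefficient `a`. -/
lemma neg_deriv_le_of_pohozaev {p U d : ℝ} (hp : 1 < p) {u u' a w V : ℝ → ℝ}
    (hu : ∀ r > 0, HasDerivAt u (u' r) r)
    (hu' : ∀ r > 0, HasDerivAt u' (-(a r * u' r) - u r ^ p) r)
    (hV : ∀ r > 0, HasDerivAt V (w r) r) (hw : ∀ r > 0, HasDerivAt w (a r * w r) r)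
    (hupos : ∀ r > 0, 0 < u r) (hVpos : ∀ r > 0, 0 < V r) (hwpos : ∀ r > 0, 0 < w r)
    (hV0 : Tendsto V (nhdsWithin 0 (Ioi 0)) (nhds 0))
    (hw0 : Tendsto w (nhdsWithin 0 (Ioi 0)) (nhds 0))
    (hu0 : Tendsto u (nhdsWithin 0 (Ioi 0)) (nhds U))
    (hu'0 : Tendsto u' (nhdsWithin 0 (Ioi 0)) (nhds d))
    (hconv : ∀ r > 0, (1 - (p - 1) / (2 * (p + 1))) * w r ≤ a r * V r) {r : ℝ} (hr : 0 < r) :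
    u' r < 0 ∧ -u' r ≤ 4 / (p + 3) * a r * u r := by
  have hneg : u' r < 0 := by
    have h : w r * u' r < 0 := by
      refine neg_of_tendsto_zero_of_hasDerivAt_neg (f := fun r => w r * u' r)
        (f' := fun r => -(w r * u r ^ p)) (fun s hs => ?_) (fun s hs => ?_)
        (by simpa using hw0.mul hu'0) hr
      · refine ((hw s hs).mul (hu' s hs)).congr_deriv ?_
        ring
      · have := mul_pos (hwpos s hs) (Real.rpow_pos_of_pos (hupos s hs) p)
        linarith
    exact (pos_iff_neg_of_mul_neg h).1 (hwpos r hr)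
  refine ⟨hneg, ?_⟩
  have hp1 : p + 1 ≠ 0 := by linarith
  have hpoh : V r * (u' r ^ 2 / 2 + u r ^ (p + 1) / (p + 1)) + w r * u r * u' r / (p + 1) ≤ 0 := by
    refine nonpos_of_tendsto_zero_of_hasDerivAt_nonpos
      (f := fun r => V r * (u' r ^ 2 / 2 + u r ^ (p + 1) / (p + 1)) + w r * u r * u' r / (p + 1))
      (f' := fun r => u' r ^ 2 * ((1 - (p - 1) / (2 * (p + 1))) * w r - a r * V r))
      (fun s hs => ?_) (fun s hs => ?_) ?_ hr
    · have h1 := ((hu s hs).rpow_const (p := p + 1) (Or.inl (hupos s hs).ne')).div_const (p + 1)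
      have h2 := ((hu' s hs).pow 2).div_const 2
      refine (((hV s hs).mul (h2.add h1)).add
        ((((hw s hs).mul (hu s hs)).mul (hu' s hs)).div_const (p + 1))).congr_deriv ?_
      have h3 : u s ^ (p + 1) = u s ^ p * u s := Real.rpow_add_one (hupos s hs).ne' p
      simp only [Pi.add_apply, Pi.mul_apply, Pi.pow_apply, add_sub_cancel_right, h3]
      field_simp
      ring
    · exact mul_nonpos_of_nonneg_of_nonpos (sq_nonneg _) (by linarith [hconv s hs])
    · have h1 := hu0.rpow_const (p := p + 1) (Or.inr (by linarith))
      simpa using (hV0.mul (((hu'0.pow 2).div_const 2).add (h1.div_const (p + 1)))).add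
        (((hw0.mul hu0).mul hu'0).div_const (p + 1))
  have hupow : 0 < u r ^ (p + 1) / (p + 1) :=
    div_pos (Real.rpow_pos_of_pos (hupos r hr) _) (by linarith)
  have hVr := hVpos r hr
  have h1 : V r * (-u' r) / 2 ≤ w r * u r / (p + 1) := by
    have h2 : V r * (u' r ^ 2 / 2) + w r * u r * u' r / (p + 1) ≤ 0 := by nlinarith
    have h3 : (-u' r) * (V r * (-u' r) / 2 - w r * u r / (p + 1)) ≤ 0 := by
      refine le_trans (le_of_eq ?_) h2; ring
    linarith [nonpos_of_mul_nonpos_right h3 (neg_pos.2 hneg)]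
  have h2 := mul_le_mul_of_nonneg_left (hconv r hr) (hupos r hr).le
  have h3 : (1 - (p - 1) / (2 * (p + 1))) = (p + 3) / (2 * (p + 1)) := by field_simp; ring
  rw [h3] at h2
  have h4 : 0 < p + 3 := by linarith
  have h5 : V r * (-u' r) ≤ V r * (4 / (p + 3) * a r * u r) := by
    have h6 : w r * u r / (p + 1) ≤ 2 / (p + 3) * (u r * (a r * V r)) := by
      refine le_trans (le_of_eq ?_) (mul_le_mul_of_nonneg_left h2 (by positivity))
      field_simp
    calc V r * (-u' r) = 2 * (V r * (-u' r) / 2) := by ring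
      _ ≤ 2 * (2 / (p + 3) * (u r * (a r * V r))) := by linarith
      _ = _ := by ring
  exact le_of_mul_le_mul_left h5 hVr

lemma exists_tendsto_of_hasDerivAt_nonpos {u u' : ℝ → ℝ}
    (hu : ∀ r > 0, HasDerivAt u (u' r) r) (hu' : ∀ r > 0, u' r ≤ 0) (hpos : ∀ r > 0, 0 < u r) :
    ∃ L, 0 ≤ L ∧ Tendsto u atTop (nhds L) := by
  have hanti := antitoneOn_of_hasDerivAt_nonpos (convex_Ioi 0) hu hu'
  have hmax : ∀ r : ℝ, 0 < max r 1 := fun r => lt_max_of_lt_right one_pos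
  have hanti' : Antitone fun r => u (max r 1) := fun r s hrs =>
    hanti (hmax r) (hmax s) (max_le_max_right 1 hrs)
  have hbdd : BddBelow (range fun r => u (max r 1)) :=
    ⟨0, by rintro _ ⟨r, rfl⟩; exact (hpos _ (hmax r)).le⟩
  have ht := tendsto_atTop_ciInf hanti' hbdd
  refine ⟨_, le_ciInf fun r => (hpos _ (hmax r)).le, ht.congr' ?_⟩
  filter_upwards [eventually_ge_atTop 1] with r hr
  rw [max_eq_left hr]

/-- A positive slowly decaying solution of `u'' + a u' + u ^ p = 0` with `a` bounded tends to
zero. -/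
lemma tendsto_zero_of_friction_bounded {p θ A : ℝ} {a v x : ℝ → ℝ} (hp : 1 < p) (hθ : 0 ≤ θ)
    (hv : ∀ r > 0, HasDerivAt v (v r ^ 2 - a r * v r + x r) r)
    (hx : ∀ r > 0, HasDerivAt x (-((p - 1) * v r * x r)) r)
    (hvpos : ∀ r > 0, 0 < v r) (hxpos : ∀ r > 0, 0 < x r)
    (hva : ∀ r > 0, v r ≤ θ * a r) (haA : ∀ᶠ r in atTop, a r ≤ A) :
    Tendsto x atTop (nhds 0) := by
  have hp1 : 0 < p - 1 := by linarith
  have hx' : ∀ r > 0, -((p - 1) * v r * x r) ≤ 0 := fun r hr => by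
    have := mul_pos (mul_pos hp1 (hvpos r hr)) (hxpos r hr)
    linarith
  obtain ⟨X, hX0, hX⟩ := exists_tendsto_of_hasDerivAt_nonpos hx hx' hxpos
  rcases hX0.eq_or_lt with rfl | hXpos
  · exact hX
  exfalso
  have hXle : ∀ᶠ r in atTop, X / 2 ≤ x r := hX.eventually_const_le (by linarith)
  have hlog : ∀ᶠ r in atTop, A / (p - 1) * Real.log (x r) - v r
      ≤ A / (p - 1) * Real.log (X / 2) - θ * A - 1 := by
    refine eventually_le_of_deriv_le (δ := X / 2) (by linarith)
      (f' := fun r => A / (p - 1) * (-((p - 1) * v r * x r) / x r)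
        - (v r ^ 2 - a r * v r + x r)) ?_
    filter_upwards [eventually_gt_atTop 0, haA, hXle] with r hr h1 h2
    refine ⟨(((hx r hr).log (hxpos r hr).ne').const_mul _).sub (hv r hr), fun _ => ?_⟩
    have h3 : A / (p - 1) * (-((p - 1) * v r * x r) / x r) = -(A * v r) := by
      have := (hxpos r hr).ne'
      field_simp
    rw [h3]
    nlinarith [mul_le_mul_of_nonneg_right h1 (hvpos r hr).le, sq_nonneg (v r)]
  obtain ⟨r, hr, h1, h2, h3⟩ :=
    ((eventually_gt_atTop 0).and (haA.and (hXle.and hlog))).exists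
  have hA : 0 ≤ A := by
    by_contra! hA
    have : θ * a r ≤ 0 := mul_nonpos_of_nonneg_of_nonpos hθ (h1.trans hA.le)
    linarith [hva r hr, hvpos r hr]
  have h4 : A / (p - 1) * Real.log (X / 2) ≤ A / (p - 1) * Real.log (x r) :=
    mul_le_mul_of_nonneg_left (Real.log_le_log (by linarith) h2) (div_nonneg hA hp1.le)
  have h5 : θ * a r ≤ θ * A := mul_le_mul_of_nonneg_left h1 hθ
  linarith [hva r hr]

/-- Asymptotic balance `a u' ∼ -u ^ p` for slowly decaying positive solutions of
`u'' + a u' + u ^ p = 0`, written for `v = -u' / u` and `x = u ^ (p - 1)`. -/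
lemma tendsto_friction_balance {p θ : ℝ} (hp : 1 < p) (hθ0 : 0 ≤ θ) (hθ : θ < 1)
    {a v x : ℝ → ℝ}
    (hv : ∀ r > 0, HasDerivAt v (v r ^ 2 - a r * v r + x r) r)
    (hx : ∀ r > 0, HasDerivAt x (-((p - 1) * v r * x r)) r)
    (hvpos : ∀ r > 0, 0 < v r) (hxpos : ∀ r > 0, 0 < x r)
    (hva : ∀ r > 0, v r ≤ θ * a r)
    (ha : (∃ l, 0 < l ∧ Tendsto a atTop (nhds l)) ∨
      (Tendsto a atTop atTop ∧ ∃ (C : ℝ) (a' : ℝ → ℝ), ∀ᶠ r in atTop,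
        HasDerivAt a (a' r) r ∧ |a' r / a r| ≤ C)) :
    Tendsto (fun r => a r * v r / x r) atTop (nhds 1) := by
  have hpos := eventually_gt_atTop (0 : ℝ)
  rcases ha with ⟨l, hl, hal⟩ | ⟨hatop, C, a', ha'⟩
  · have hab : Tendsto (fun r => a r / l) atTop (nhds 1) := by
      simpa [hl.ne'] using hal.div_const l
    have hx0 : Tendsto x atTop (nhds 0) :=
      tendsto_zero_of_friction_bounded hp hθ0 hv hx hvpos hxpos hva
        (hal.eventually_le_const (lt_add_one l))
    have h := riccati_slow_branch (b := fun _ => l) (b' := fun _ => 0) hθ hl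
      (hpos.mono hv) (hpos.mono hx) (Eventually.of_forall fun r => hasDerivAt_const r l)
      (hpos.mono hvpos) (hpos.mono hxpos) (Eventually.of_forall fun _ => le_rfl)
      (hpos.mono hva) (by simp) hab (by simpa using hx0.div_const (l ^ 2))
    have h2 := hab.mul h
    rw [one_mul] at h2
    refine h2.congr fun r => ?_
    field_simp
  · obtain ⟨X, -, hX⟩ := exists_tendsto_of_hasDerivAt_nonpos hx (fun r hr => by
      have := mul_pos (mul_pos (by linarith : 0 < p - 1) (hvpos r hr)) (hxpos r hr)
      linarith) hxpos
    refine riccati_slow_branch (b' := a') hθ one_pos (hpos.mono hv) (hpos.mono hx)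
      (ha'.mono fun r h => h.1) (hpos.mono hvpos) (hpos.mono hxpos)
      (hatop.eventually_ge_atTop 1) (hpos.mono hva) ?_ ?_ ?_
    · refine squeeze_zero_norm' ?_ (tendsto_const_nhds.div_atTop hatop :
        Tendsto (fun r => C / a r) atTop (nhds 0))
      filter_upwards [ha', hatop.eventually_gt_atTop 0] with r hr har
      rw [sq, ← div_div, norm_div, Real.norm_eq_abs, Real.norm_of_nonneg har.le]
      exact div_le_div_of_nonneg_right hr.2 har.le
    · refine tendsto_const_nhds.congr' ?_
      filter_upwards [hatop.eventually_gt_atTop 0] with r har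
      rw [div_self har.ne']
    · exact hX.div_atTop ((tendsto_pow_atTop two_ne_zero).comp hatop)

lemma H1.continuousOn_deriv {ψ : ℝ → ℝ} (h1 : H1 ψ) : ContinuousOn (deriv ψ) (Ici 0) := by
  refine (ContDiffOn.continuousOn_derivWithin_Ici h1.1).congr fun r hr => ?_
  rcases (mem_Ici.1 hr).eq_or_lt with rfl | hr
  · have hd : DifferentiableAt ℝ ψ 0 :=
      differentiableAt_of_deriv_ne_zero (by rw [h1.2.2.1]; exact one_ne_zero)
    exact (hd.derivWithin (uniqueDiffOn_Ici 0 0 self_mem_Ici)).symm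
  · exact (derivWithin_Ici_of_pos ψ hr).symm

lemma H1.hasDerivAt_pow {ψ : ℝ → ℝ} (h1 : H1 ψ) {n : ℕ} (hn : 2 ≤ n) {r : ℝ} (hr : 0 < r) :
    HasDerivAt (fun r => ψ r ^ (n - 1))
      (((n : ℝ) - 1) * (deriv ψ r / ψ r) * ψ r ^ (n - 1)) r := by
  refine ((ContDiffOn.hasDerivAt_of_pos h1.1 hr).1.pow (n - 1)).congr_deriv ?_
  have hψ := (h1.2.2.2.2 r hr).ne'
  obtain ⟨k, rfl⟩ : ∃ k, n = k + 2 := ⟨n - 2, by omega⟩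
  simp only [show k + 2 - 1 = k + 1 by omega, Nat.add_sub_cancel]
  push_cast
  field_simp
  ring

/-- The volume `∫₀^r ψ ^ (n - 1)` of a ball, up to a constant factor. -/
def ballVolume (n : ℕ) (ψ : ℝ → ℝ) (r : ℝ) : ℝ := ∫ s in Ioc 0 r, ψ s ^ (n - 1)

lemma H1.hasDerivAt_ballVolume {ψ : ℝ → ℝ} (h1 : H1 ψ) (n : ℕ) {r : ℝ} (hr : 0 < r) :
    HasDerivAt (ballVolume n ψ) (ψ r ^ (n - 1)) r :=
  hasDerivAt_setIntegral_Ioc (h1.1.continuousOn.pow (n - 1)) hr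

lemma H1.ballVolume_pos {ψ : ℝ → ℝ} (h1 : H1 ψ) (n : ℕ) {r : ℝ} (hr : 0 < r) :
    0 < ballVolume n ψ r :=
  setIntegral_Ioc_pos (h1.1.continuousOn.pow (n - 1))
    (fun s hs => pow_pos (h1.2.2.2.2 s hs) _) hr

lemma H1.volume_ineq {ψ : ℝ → ℝ} (h1 : H1 ψ) {n : ℕ} (hn : 2 ≤ n) {p : ℝ} (hp : 1 < p)
    (hA : ConvexOn ℝ (Ici 0) (Afun n p ψ)) {r : ℝ} (hr : 0 < r) :
    (1 - (p - 1) / (2 * (p + 1))) * ψ r ^ (n - 1)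
      ≤ ((n : ℝ) - 1) * (deriv ψ r / ψ r) * ballVolume n ψ r :=
  mul_le_mul_of_convexOn_rpow (w := fun r => ψ r ^ (n - 1))
    (a := fun r => ((n : ℝ) - 1) * (deriv ψ r / ψ r))
    (div_pos (by linarith) (by linarith)) (fun _ hs => h1.hasDerivAt_ballVolume n hs)
    (fun _ hs => h1.hasDerivAt_pow hn hs) (fun _ hs => h1.ballVolume_pos n hs)
    (fun s hs => pow_pos (h1.2.2.2.2 s hs) _) hA hr

lemma H1.deriv_pos {ψ : ℝ → ℝ} (h1 : H1 ψ) {n : ℕ} (hn : 2 ≤ n) {p : ℝ} (hp : 1 < p)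
    (hA : ConvexOn ℝ (Ici 0) (Afun n p ψ)) {r : ℝ} (hr : 0 < r) : 0 < deriv ψ r := by
  have hψ := h1.2.2.2.2 r hr
  have hn1 : (0 : ℝ) < (n : ℝ) - 1 := by
    have : (2 : ℝ) ≤ n := by exact_mod_cast hn
    linarith
  have hq : 0 < 1 - (p - 1) / (2 * (p + 1)) := by
    have : (p - 1) / (2 * (p + 1)) < 1 := by
      rw [div_lt_one (by linarith)]; linarith
    linarith
  have h := lt_of_lt_of_le (mul_pos hq (pow_pos hψ (n - 1))) (h1.volume_ineq hn hp hA hr)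
  have h2 := (pos_iff_pos_of_mul_pos h).2 (h1.ballVolume_pos n hr)
  have h3 := (pos_iff_pos_of_mul_pos h2).1 hn1
  exact (div_pos_iff_of_pos_right hψ).1 h3

lemma IsRadialSolution.deriv_bounds {n : ℕ} (hn : 2 ≤ n) {p : ℝ} (hp : 1 < p) {ψ : ℝ → ℝ}
    (h1 : H1 ψ) (hA : ConvexOn ℝ (Ici 0) (Afun n p ψ)) {u : ℝ → ℝ} {α : ℝ}
    (hu : IsRadialSolution n p ψ u α) (hupos : ∀ r > 0, 0 < u r) {r : ℝ} (hr : 0 < r) :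
    deriv u r < 0 ∧
      -deriv u r ≤ 4 / (p + 3) * (((n : ℝ) - 1) * (deriv ψ r / ψ r)) * u r := by
  have hc : ∀ {f : ℝ → ℝ}, ContinuousOn f (Ici 0) →
      Tendsto f (nhdsWithin 0 (Ioi 0)) (nhds (f 0)) := fun hf =>
    (hf 0 self_mem_Ici).mono_left (nhdsWithin_mono 0 Ioi_subset_Ici_self)
  have hw : ContinuousOn (fun r => ψ r ^ (n - 1)) (Ici 0) := h1.1.continuousOn.pow (n - 1)
  have hw0 := hc hw
  have hu'0 := hc (ContDiffOn.continuousOn_derivWithin_Ici hu.1)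
  refine neg_deriv_le_of_pohozaev (U := u 0) (d := derivWithin u (Ici 0) 0)
    (a := fun r => ((n : ℝ) - 1) * (deriv ψ r / ψ r)) hp
    (fun s hs => (ContDiffOn.hasDerivAt_of_pos hu.1 hs).1) (fun s hs => ?_)
    (fun _ hs => h1.hasDerivAt_ballVolume n hs) (fun _ hs => h1.hasDerivAt_pow hn hs) hupos
    (fun _ hs => h1.ballVolume_pos n hs) (fun s hs => pow_pos (h1.2.2.2.2 s hs) _)
    (tendsto_setIntegral_Ioc_zero hw) ?_ (hc hu.1.continuousOn) (hu'0.congr' ?_)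
    (fun s hs => h1.volume_ineq hn hp hA hs) hr
  · refine (ContDiffOn.hasDerivAt_of_pos hu.1 hs).2.congr_deriv ?_
    have h := hu.2.2.2 s hs
    have h2 : |u s| ^ (p - 1) * u s = u s ^ p := by
      rw [abs_of_pos (hupos s hs), ← Real.rpow_add_one (hupos s hs).ne', sub_add_cancel]
    rw [h2] at h
    linarith
  · simpa [h1.2.1, zero_pow (show n - 1 ≠ 0 by omega)] using hw0
  · filter_upwards [self_mem_nhdsWithin] with s hs
    exact derivWithin_Ici_of_pos u hs

lemma IsRadialSolution.tendsto_balance {n : ℕ} (hn : 2 ≤ n) {p : ℝ} (hp : 1 < p) {ψ : ℝ → ℝ}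
    (h1 : H1 ψ)
    (hl : (∃ l : ℝ, 0 < l ∧ Tendsto (fun r => deriv ψ r / ψ r) atTop (nhds l)) ∨
          (Tendsto (fun r => deriv ψ r / ψ r) atTop atTop ∧ LogDerivBounded ψ))
    (hA : ConvexOn ℝ (Ici 0) (Afun n p ψ)) {u : ℝ → ℝ} {α : ℝ}
    (hu : IsRadialSolution n p ψ u α) (hupos : ∀ r > 0, 0 < u r) :
    Tendsto (fun r => ((n : ℝ) - 1) * (deriv ψ r / ψ r) * (-deriv u r / u r) / u r ^ (p - 1))
      atTop (nhds 1) := by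
  have hn1 : (0 : ℝ) < (n : ℝ) - 1 := by
    have : (2 : ℝ) ≤ n := by exact_mod_cast hn
    linarith
  have hb := fun {r : ℝ} (hr : 0 < r) => hu.deriv_bounds hn hp h1 hA hupos hr
  refine tendsto_friction_balance (p := p) (θ := 4 / (p + 3)) hp
    (div_nonneg (by norm_num) (by linarith)) (by rw [div_lt_one (by linarith)]; linarith)
    (a := fun r => ((n : ℝ) - 1) * (deriv ψ r / ψ r)) (v := fun r => -deriv u r / u r)
    (x := fun r => u r ^ (p - 1)) (fun r hr => ?_) (fun r hr => ?_)
    (fun r hr => div_pos (neg_pos.2 (hb hr).1) (hupos r hr))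
    (fun r hr => Real.rpow_pos_of_pos (hupos r hr) _)
    (fun r hr => (div_le_iff₀ (hupos r hr)).2 (hb hr).2) ?_
  · obtain ⟨hd, hdd⟩ := ContDiffOn.hasDerivAt_of_pos hu.1 hr
    have hur := hupos r hr
    refine (hdd.neg.div hd hur.ne').congr_deriv ?_
    have h := hu.2.2.2 r hr
    rw [abs_of_pos hur] at h
    have h2 : deriv (deriv u) r
        = -(((n : ℝ) - 1) * (deriv ψ r / ψ r) * deriv u r) - u r ^ (p - 1) * u r := by linarith
    rw [h2]
    have hψ := (h1.2.2.2.2 r hr).ne'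
    simp only [Pi.neg_apply]
    field_simp
    ring
  · refine ((ContDiffOn.hasDerivAt_of_pos hu.1 hr).1.rpow_const
      (Or.inl (hupos r hr).ne')).congr_deriv ?_
    have hur := (hupos r hr).ne'
    rw [Real.rpow_sub_one hur (p - 1)]
    field_simp
  · rcases hl with ⟨l, hl, ht⟩ | ⟨ht, C, hC⟩
    · exact Or.inl ⟨_, mul_pos hn1 hl, ht.const_mul _⟩
    · refine Or.inr ⟨ht.const_mul_atTop hn1, C,
        fun r => ((n : ℝ) - 1) * deriv (fun s => deriv ψ s / ψ s) r, ?_⟩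
      filter_upwards [hC, eventually_gt_atTop 0] with r hr hr0
      obtain ⟨hd, hdd⟩ := ContDiffOn.hasDerivAt_of_pos h1.1 hr0
      have hψ := h1.2.2.2.2 r hr0
      have hm : HasDerivAt (fun s => deriv ψ s / ψ s) (deriv (fun s => deriv ψ s / ψ s) r) r :=
        (hdd.div hd hψ.ne').differentiableAt.hasDerivAt
      refine ⟨hm.const_mul _, ?_⟩
      rw [mul_div_mul_left _ _ hn1.ne']
      rwa [(hm.log (div_pos (h1.deriv_pos hn hp hA hr0) hψ).ne').deriv] at hr

/-- Asymptotic behavior of positive radial solutions in the supercritical case. -/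
theorem statement12 (n : ℕ) (hn : 3 ≤ n) (p : ℝ) (hp : 1 < p)
    (hsuper : ((n : ℝ) + 2) / ((n : ℝ) - 2) ≤ p) (ψ : ℝ → ℝ)
    (h1 : H1 ψ) (h2 : H2 ψ)
    (hl : (∃ l : ℝ, 0 < l ∧ Tendsto (fun r => deriv ψ r / ψ r) atTop (nhds l)) ∨
          (Tendsto (fun r => deriv ψ r / ψ r) atTop atTop ∧ LogDerivBounded ψ))
    (hA : ConvexOn ℝ (Ici 0) (Afun n p ψ))
    (u : ℝ → ℝ) (α : ℝ) (hu : IsRadialSolution n p ψ u α)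
    (hupos : ∀ r ≥ (0:ℝ), 0 < u r) :
    (IntegrableOn (fun s => ψ s / deriv ψ s) (Ioi 0) →
      ∃ L : ℝ, 0 < L ∧ Tendsto u atTop (nhds L)) ∧
    (¬ IntegrableOn (fun s => ψ s / deriv ψ s) (Ioi 0) →
      Tendsto (fun r => (∫ s in Ioc (0:ℝ) r, ψ s / deriv ψ s) ^ (1 / (p - 1)) * u r)
        atTop (nhds ((((n : ℝ) - 1) / (p - 1)) ^ (1 / (p - 1)))) ∧
      ∀ l : ℝ, 0 < l → Tendsto (fun r => deriv ψ r / ψ r) atTop (nhds l) →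
        Tendsto (fun r => r ^ (1 / (p - 1)) * u r) atTop
          (nhds ((l * ((n : ℝ) - 1) / (p - 1)) ^ (1 / (p - 1))))) := by
  have hn2 : 2 ≤ n := by omega
  have hn1 : (0 : ℝ) < (n : ℝ) - 1 := by
    have : (3 : ℝ) ≤ n := by exact_mod_cast hn
    linarith
  have hp1 : 0 < p - 1 := by linarith
  have hupos' : ∀ r > 0, 0 < u r := fun r hr => hupos r hr.le
  have hψ' : ∀ r > 0, 0 < deriv ψ r := fun r hr => h1.deriv_pos hn2 hp hA hr
  have hgpos : ∀ r > 0, 0 < ψ r / deriv ψ r := fun r hr =>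
    div_pos (h1.2.2.2.2 r hr) (hψ' r hr)
  have hgcont : ContinuousOn (fun s => ψ s / deriv ψ s) (Ici 0) := by
    refine h1.1.continuousOn.div h1.continuousOn_deriv fun r hr => ?_
    rcases (mem_Ici.1 hr).eq_or_lt with rfl | hr
    · rw [h1.2.2.1]; exact one_ne_zero
    · exact (hψ' r hr).ne'
  have hbal := hu.tendsto_balance hn2 hp h1 hl hA hupos'
  set G : ℝ → ℝ := fun r => ∫ s in Ioc (0:ℝ) r, ψ s / deriv ψ s with hGdef
  have hG : ∀ r > 0, HasDerivAt G (ψ r / deriv ψ r) r := fun r hr =>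
    hasDerivAt_setIntegral_Ioc hgcont hr
  have hF : ∀ r > 0, HasDerivAt (fun r => (u r ^ (p - 1))⁻¹)
      ((p - 1) * (-deriv u r / u r) / u r ^ (p - 1)) r := by
    intro r hr
    have hur := (hupos' r hr).ne'
    have hx := (Real.rpow_pos_of_pos (hupos' r hr) (p - 1)).ne'
    refine (((ContDiffOn.hasDerivAt_of_pos hu.1 hr).1.rpow_const
      (Or.inl hur)).inv hx).congr_deriv ?_
    rw [Real.rpow_sub_one hur (p - 1)]
    field_simp
  have hquot : Tendsto (fun r => (p - 1) * (-deriv u r / u r) / u r ^ (p - 1)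
      / (ψ r / deriv ψ r)) atTop (nhds ((p - 1) / ((n : ℝ) - 1))) := by
    have h := hbal.const_mul ((p - 1) / ((n : ℝ) - 1))
    rw [mul_one] at h
    refine h.congr fun r => ?_
    field_simp
  have hpos := eventually_gt_atTop (0 : ℝ)
  refine ⟨fun hint => ?_, fun hint => ?_⟩
  · obtain ⟨L, hL0, hL⟩ := exists_tendsto_of_hasDerivAt_nonpos
      (fun r hr => (ContDiffOn.hasDerivAt_of_pos hu.1 hr).1)
      (fun r hr => (hu.deriv_bounds hn2 hp h1 hA hupos' hr).1.le) hupos'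
    refine ⟨L, hL0.lt_of_ne ?_, hL⟩
    rintro rfl
    set K := (p - 1) / ((n : ℝ) - 1) + 1 with hK
    have hK0 : 0 < K := add_pos (div_pos hp1 hn1) one_pos
    obtain ⟨R, hR⟩ := eventually_atTop.1 (hpos.and (hquot.eventually_le_const (lt_add_one _)))
    have hanti : AntitoneOn (fun r => (u r ^ (p - 1))⁻¹ - K * G r) (Ici R) :=
      antitoneOn_of_hasDerivAt_nonpos (convex_Ici R)
        (fun r hr => (hF r (hR r hr).1).sub ((hG r (hR r hr).1).const_mul K))
        (fun r hr => by
          have h := (div_le_iff₀ (hgpos r (hR r hr).1)).1 (hR r hr).2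
          linarith)
    have hx0 : Tendsto (fun r => u r ^ (p - 1)) atTop (nhdsWithin 0 (Ioi 0)) := by
      refine tendsto_nhdsWithin_iff.2 ⟨?_, hpos.mono fun r hr =>
        Real.rpow_pos_of_pos (hupos' r hr) _⟩
      simpa [Real.zero_rpow hp1.ne'] using hL.rpow_const (p := p - 1) (Or.inr hp1.le)
    obtain ⟨r, hr, hbig⟩ := ((eventually_ge_atTop R).and
      ((tendsto_inv_nhdsGT_zero.comp hx0).eventually_gt_atTop
        ((u R ^ (p - 1))⁻¹ - K * G R + K * ∫ s in Ioi (0:ℝ), ψ s / deriv ψ s))).exists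
    have h2 := hanti (mem_Ici.2 le_rfl) (mem_Ici.2 hr) hr
    have h3 := mul_le_mul_of_nonneg_left
      (setIntegral_Ioc_le_Ioi (fun s hs => (hgpos s hs).le) hint r) hK0.le
    simp only [Function.comp] at hbig h2
    linarith
  · have hGtop : Tendsto G atTop atTop :=
      tendsto_setIntegral_Ioc_atTop hgcont (fun s hs => (hgpos s hs).le) hint
    have hlim : Tendsto (fun r => G r ^ (1 / (p - 1)) * u r) atTop
        (nhds ((((n : ℝ) - 1) / (p - 1)) ^ (1 / (p - 1)))) := by
      have hFG := tendsto_div_of_deriv_div (hpos.mono hF) (hpos.mono hG) (hpos.mono hgpos)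
        hquot hGtop
      have hinv := (hFG.inv₀ (div_pos hp1 hn1).ne').rpow_const (p := 1 / (p - 1))
        (Or.inr (one_div_pos.2 hp1).le)
      rw [inv_div] at hinv
      refine hinv.congr' ?_
      filter_upwards [hpos, hGtop.eventually_gt_atTop 0] with r hr hGr
      have hur := hupos' r hr
      rw [inv_div, div_inv_eq_mul, Real.mul_rpow hGr.le (Real.rpow_nonneg hur.le _),
        ← Real.rpow_mul hur.le, mul_one_div_cancel hp1.ne', Real.rpow_one]
    refine ⟨hlim, fun l hl0 hlt => ?_⟩
    have hGr : Tendsto (fun r => G r / r) atTop (nhds l⁻¹) := by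
      refine tendsto_div_of_deriv_div (G' := fun _ => 1) (hpos.mono hG)
        (Eventually.of_forall fun r => hasDerivAt_id r)
        (Eventually.of_forall fun _ => one_pos) ?_ tendsto_id
      refine (hlt.inv₀ hl0.ne').congr fun r => ?_
      rw [inv_div, div_one]
    have hinv := (hGr.inv₀ (inv_pos.2 hl0).ne').rpow_const (p := 1 / (p - 1))
      (Or.inr (one_div_pos.2 hp1).le)
    rw [inv_inv] at hinv
    have h := hinv.mul hlim
    rw [← Real.mul_rpow hl0.le (div_pos hn1 hp1).le, ← mul_div_assoc] at h
    refine h.congr' ?_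
    filter_upwards [hpos, hGtop.eventually_gt_atTop 0] with r hr hGr
    rw [← mul_assoc, inv_div, ← Real.mul_rpow (div_nonneg hr.le hGr.le) hGr.le,
      div_mul_cancel₀ _ hGr.ne']
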